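/- arXiv:1307.4782 — 2 statements merged into one kernel-verified Lean document; each statement's English description precedes it below -/
import Mathlib

section
/- Let p be a prime number and let ℚ_p(t) denote the field of rational functions in one variable over the p-adic field ℚ_p. Then there do not exist elements x₁, y₁, x₂, y₂, x₃, y₃ ∈ ℚ_p(t) satisfying (x₁² − t·y₁²)(x₂² − (1+t)·y₂²)(x₃² − t(1+t)·y₃²) = p. -/
open Polynomial in
/-- The embedding of `ℤ_p[t]` into `ℚ_p(t)`. -/
noncomputable def toRat (p : ℕ) [Fact p.Prime] : ℤ_[p][X] →+* RatFunc ℚ_[p] :=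
  (algebraMap ℚ_[p][X] (RatFunc ℚ_[p])).comp (mapRingHom (algebraMap ℤ_[p] ℚ_[p]))

lemma toRat_injective (p : ℕ) [Fact p.Prime] : Function.Injective (toRat p) :=
  (IsFractionRing.injective (Polynomial ℚ_[p]) (RatFunc ℚ_[p])).comp
    (Polynomial.map_injective _ (IsFractionRing.injective ℤ_[p] ℚ_[p]))

open Polynomial in
lemma clear_denom (p : ℕ) [Fact p.Prime] (f : ℚ_[p][X]) :
    ∃ (b : ℤ_[p]) (g : ℤ_[p][X]), b ≠ 0 ∧
      g.map (algebraMap ℤ_[p] ℚ_[p]) = (C b).map (algebraMap ℤ_[p] ℚ_[p]) * f := by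
  obtain ⟨b, hb, h⟩ := IsLocalization.integerNormalization_spec (nonZeroDivisors ℤ_[p]) f
  refine ⟨b, _, nonZeroDivisors.ne_zero hb, h.trans ?_⟩
  rw [map_C, ← smul_eq_C_mul, algebraMap_smul]

open Polynomial in
lemma toRat_div (p : ℕ) [Fact p.Prime] (x : RatFunc ℚ_[p]) :
    ∃ a b : ℤ_[p][X], b ≠ 0 ∧ toRat p a / toRat p b = x := by
  obtain ⟨A, B, hB, rfl⟩ := IsFractionRing.div_surjective (A := ℚ_[p][X]) x
  have hB0 : B ≠ 0 := nonZeroDivisors.ne_zero hB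
  obtain ⟨u, a, hu, ha⟩ := clear_denom p A
  obtain ⟨v, b, hv, hb⟩ := clear_denom p B
  have hinj := Polynomial.map_injective _ (IsFractionRing.injective ℤ_[p] ℚ_[p])
  have hb0 : b ≠ 0 := by
    rintro rfl
    rw [Polynomial.map_zero] at hb
    have := (mul_eq_zero.mp hb.symm).resolve_right hB0
    rw [← Polynomial.map_zero (algebraMap ℤ_[p] ℚ_[p])] at this
    exact hv (C_eq_zero.mp (hinj this))
  have hu0 : toRat p (C u) ≠ 0 := by
    rw [Ne, map_eq_zero_iff _ (toRat_injective p), C_eq_zero]; exact hu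
  have hv0 : toRat p (C v) ≠ 0 := by
    rw [Ne, map_eq_zero_iff _ (toRat_injective p), C_eq_zero]; exact hv
  have hB1 : algebraMap ℚ_[p][X] (RatFunc ℚ_[p]) B ≠ 0 := by
    rwa [Ne, map_eq_zero_iff _ (IsFractionRing.injective ℚ_[p][X] (RatFunc ℚ_[p]))]
  have ea : toRat p a = toRat p (C u) * algebraMap ℚ_[p][X] (RatFunc ℚ_[p]) A := by
    simp only [toRat, RingHom.comp_apply, coe_mapRingHom]; rw [ha, map_mul]
  have eb : toRat p b = toRat p (C v) * algebraMap ℚ_[p][X] (RatFunc ℚ_[p]) B := by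
    simp only [toRat, RingHom.comp_apply, coe_mapRingHom]; rw [hb, map_mul]
  refine ⟨C v * a, C u * b, mul_ne_zero (C_ne_zero.mpr hu) hb0, ?_⟩
  rw [map_mul, map_mul, ea, eb]
  field_simp

open Polynomial in
lemma nonsq_aux {F : Type*} [Field F] (d e : F[X]) (r : F) (hd : d = (X - C r) * e)
    (he : e.eval r ≠ 0) (a c : F[X]) (h : a ^ 2 - d * c ^ 2 = 0) : a = 0 ∧ c = 0 := by
  have he0 : e ≠ 0 := by rintro rfl; simp at he
  have hX : (X - C r) ≠ 0 := X_sub_C_ne_zero r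
  have hd0 : d ≠ 0 := by rw [hd]; exact mul_ne_zero hX he0
  have h' : a ^ 2 = d * c ^ 2 := sub_eq_zero.mp h
  by_cases hc : c = 0
  · subst hc
    refine ⟨?_, rfl⟩
    simpa using h'
  exfalso
  have ha : a ≠ 0 := by
    rintro rfl
    have : d * c ^ 2 ≠ 0 := mul_ne_zero hd0 (pow_ne_zero _ hc)
    apply this; rw [← h']; simp
  have hm := congrArg (rootMultiplicity r) h'
  rw [rootMultiplicity_mul (mul_ne_zero hd0 (pow_ne_zero _ hc)), pow_two, pow_two,
    rootMultiplicity_mul (mul_ne_zero ha ha), rootMultiplicity_mul (mul_ne_zero hc hc), hd,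
    rootMultiplicity_mul (mul_ne_zero hX he0), rootMultiplicity_X_sub_C_self,
    rootMultiplicity_eq_zero (p := e) (x := r) he] at hm
  omega

open Polynomial in
lemma dvd_of_map_zero (p : ℕ) [Fact p.Prime] (f : ℤ_[p][X])
    (h : f.map (PadicInt.toZMod (p := p)) = 0) : C (p : ℤ_[p]) ∣ f := by
  rw [C_dvd_iff_dvd_coeff]
  intro i
  have : PadicInt.toZMod (f.coeff i) = 0 := by rw [← coeff_map, h, coeff_zero]
  rw [← RingHom.mem_ker, PadicInt.ker_toZMod, PadicInt.maximalIdeal_eq_span_p,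
    Ideal.mem_span_singleton] at this
  exact this

open Polynomial in
lemma map_p_zero (p : ℕ) [Fact p.Prime] :
    (C (p : ℤ_[p])).map (PadicInt.toZMod (p := p)) = 0 := by
  simp

open Polynomial in
lemma extract_one (p : ℕ) [Fact p.Prime] (f : ℤ_[p][X]) (hf : f ≠ 0) :
    ∃ (n : ℕ) (g : ℤ_[p][X]), f = C (p : ℤ_[p]) ^ n * g ∧
      g.map (PadicInt.toZMod (p := p)) ≠ 0 := by
  have hp : ¬ IsUnit (C (p : ℤ_[p])) := by
    intro h
    have := h.map (mapRingHom (PadicInt.toZMod (p := p)))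
    rw [coe_mapRingHom, map_p_zero] at this
    exact not_isUnit_zero this
  obtain ⟨n, g, hg, h⟩ := WfDvdMonoid.max_power_factor' hf hp
  exact ⟨n, g, h, fun h0 => hg (dvd_of_map_zero p g h0)⟩

open Polynomial in
lemma extract_two (p : ℕ) [Fact p.Prime] (f g : ℤ_[p][X]) (hf : ¬ (f = 0 ∧ g = 0)) :
    ∃ (n : ℕ) (f' g' : ℤ_[p][X]), f = C (p : ℤ_[p]) ^ n * f' ∧ g = C (p : ℤ_[p]) ^ n * g' ∧
      ¬ (f'.map (PadicInt.toZMod (p := p)) = 0 ∧ g'.map (PadicInt.toZMod (p := p)) = 0) := by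
  by_cases h1 : f = 0
  · obtain ⟨n, g', h, h'⟩ := extract_one p g (fun h => hf ⟨h1, h⟩)
    exact ⟨n, 0, g', by simp [h1], h, fun h => h' h.2⟩
  obtain ⟨n, f', hn, hn'⟩ := extract_one p f h1
  by_cases h2 : g = 0
  · exact ⟨n, f', 0, hn, by simp [h2], fun h => hn' h.1⟩
  obtain ⟨m, g', hm, hm'⟩ := extract_one p g h2
  rcases le_total n m with h | h
  · obtain ⟨k, rfl⟩ := Nat.exists_eq_add_of_le h
    exact ⟨n, f', C (p : ℤ_[p]) ^ k * g', hn, by rw [hm]; ring, fun h => hn' h.1⟩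
  · obtain ⟨k, rfl⟩ := Nat.exists_eq_add_of_le h
    exact ⟨m, C (p : ℤ_[p]) ^ k * f', g', by rw [hn]; ring, hm, fun h => hm' h.2⟩

open Polynomial in
/-- Even Gauss valuation. -/
def EvenVal (p : ℕ) [Fact p.Prime] (z : RatFunc ℚ_[p]) : Prop :=
  ∃ (k l : ℕ) (a b : ℤ_[p][X]), a.map (PadicInt.toZMod (p := p)) ≠ 0 ∧
    b.map (PadicInt.toZMod (p := p)) ≠ 0 ∧
    z * toRat p (C (p : ℤ_[p]) ^ (2 * k) * b) =
      toRat p (C (p : ℤ_[p]) ^ (2 * l) * a)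

lemma EvenVal.mul {p : ℕ} [Fact p.Prime] {z w : RatFunc ℚ_[p]} (hz : EvenVal p z)
    (hw : EvenVal p w) : EvenVal p (z * w) := by
  obtain ⟨k, l, a, b, ha, hb, h⟩ := hz
  obtain ⟨k', l', a', b', ha', hb', h'⟩ := hw
  refine ⟨k + k', l + l', a * a', b * b', ?_, ?_, ?_⟩
  · rw [Polynomial.map_mul]; exact mul_ne_zero ha ha'
  · rw [Polynomial.map_mul]; exact mul_ne_zero hb hb'
  · have := congrArg₂ (· * ·) h h'
    simp only [map_mul, map_pow] at this ⊢
    linear_combination this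

open Polynomial in
lemma evenVal_norm (p : ℕ) [Fact p.Prime] (d : ℤ_[p][X])
    (hd : ∀ a c : (ZMod p)[X], a ^ 2 - d.map (PadicInt.toZMod (p := p)) * c ^ 2 = 0 →
      a = 0 ∧ c = 0)
    (x y : RatFunc ℚ_[p])
    (h : x ^ 2 - toRat p d * y ^ 2 ≠ 0) :
    EvenVal p (x ^ 2 - toRat p d * y ^ 2) := by
  obtain ⟨A, B, hB0, rfl⟩ := toRat_div p x
  obtain ⟨A', B', hB0', rfl⟩ := toRat_div p y
  have inj := toRat_injective p
  have i1 : toRat p B ≠ 0 := by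
    rwa [Ne, map_eq_zero_iff _ inj]
  have i2 : toRat p B' ≠ 0 := by
    rwa [Ne, map_eq_zero_iff _ inj]
  have hne : ¬ (A * B' = 0 ∧ A' * B = 0) := by
    rintro ⟨h1, h2⟩
    have h1 : A = 0 := by simpa [hB0'] using h1
    have h2 : A' = 0 := by simpa [hB0] using h2
    apply h; simp [h1, h2]
  obtain ⟨l, f, g, hf, hg, hfg⟩ := extract_two p _ _ hne
  obtain ⟨k, b, hb, hb'⟩ := extract_one p (B * B') (mul_ne_zero hB0 hB0')
  refine ⟨k, l, f ^ 2 - d * g ^ 2, b ^ 2, ?_, ?_, ?_⟩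
  · intro h0
    apply hfg
    apply hd
    simpa using h0
  · rw [Polynomial.map_pow]; exact pow_ne_zero _ hb'
  · have e1 : C (p : ℤ_[p]) ^ (2 * k) * b ^ 2 = (B * B') ^ 2 := by rw [hb]; ring
    have e2 : C (p : ℤ_[p]) ^ (2 * l) * (f ^ 2 - d * g ^ 2) =
        (A * B') ^ 2 - d * (A' * B) ^ 2 := by rw [hf, hg]; ring
    rw [e1, e2]
    simp only [map_mul, map_pow, map_sub]
    field_simp

open Polynomial in
lemma not_evenVal_p (p : ℕ) [Fact p.Prime] : ¬ EvenVal p (RatFunc.C (p : ℚ_[p])) := by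
  rintro ⟨k, l, a, b, ha, hb, h⟩
  have inj := toRat_injective p
  have hp : RatFunc.C (p : ℚ_[p]) =
      toRat p (C (p : ℤ_[p])) := by simp [toRat]
  rw [hp, ← map_mul] at h
  have h := inj h
  have hp0 : C (p : ℤ_[p]) ≠ 0 := by
    simp [(Fact.out : p.Prime).ne_zero]
  have key : ∀ (n : ℕ) (f g : ℤ_[p][X]), f.map (PadicInt.toZMod (p := p)) ≠ 0 →
      f ≠ C (p : ℤ_[p]) ^ (n + 1) * g := by
    rintro n f g hf rfl
    apply hf
    rw [Polynomial.map_mul, Polynomial.map_pow, map_p_zero]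
    simp
  rcases lt_or_ge (2 * k) (2 * l) with hl | hl
  · obtain ⟨j, rfl⟩ := Nat.exists_eq_add_of_lt (show k < l by omega)
    refine key (2 * j) b a hb (mul_left_cancel₀ (pow_ne_zero (2 * k + 1) hp0) ?_)
    rw [show 2 * (k + j + 1) = 2 * k + 1 + (2 * j + 1) by ring] at h
    linear_combination h
  · obtain ⟨j, rfl⟩ := Nat.exists_eq_add_of_le (show l ≤ k by omega)
    refine key (2 * j) a b ha (mul_left_cancel₀ (pow_ne_zero (2 * l) hp0) ?_)
    linear_combination -h

/-- Over `ℚ_p(t)` there is no solution of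
`(x₁² - t·y₁²)(x₂² - (1+t)·y₂²)(x₃² - t(1+t)·y₃²) = p`. -/
theorem no_rational_point_on_torsor (p : ℕ) [Fact p.Prime] :
    ¬ ∃ x₁ y₁ x₂ y₂ x₃ y₃ : RatFunc ℚ_[p],
      (x₁ ^ 2 - RatFunc.X * y₁ ^ 2) * (x₂ ^ 2 - (1 + RatFunc.X) * y₂ ^ 2) *
        (x₃ ^ 2 - RatFunc.X * (1 + RatFunc.X) * y₃ ^ 2) = RatFunc.C (p : ℚ_[p]) := by
  rintro ⟨x₁, y₁, x₂, y₂, x₃, y₃, h⟩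
  have hX : (RatFunc.X : RatFunc ℚ_[p]) =
      toRat p Polynomial.X := by
    simp [toRat]
  have hp0 : RatFunc.C (p : ℚ_[p]) ≠ 0 := by
    simp [(Fact.out : p.Prime).ne_zero]
  have h0 := hp0
  rw [← h] at h0
  have h3 := right_ne_zero_of_mul h0
  have h12 := left_ne_zero_of_mul h0
  have h2 := right_ne_zero_of_mul h12
  have h1 := left_ne_zero_of_mul h12
  apply not_evenVal_p p
  rw [← h]
  rw [hX, ← map_one (toRat p), ← map_add, ← map_mul] at *
  refine EvenVal.mul (EvenVal.mul ?_ ?_) ?_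
  · exact evenVal_norm p _ (nonsq_aux _ 1 0 (by simp) (by simp)) _ _ h1
  · exact evenVal_norm p _ (nonsq_aux _ 1 (-1) (by simp [add_comm]) (by simp)) _ _ h2
  · exact evenVal_norm p _ (nonsq_aux _ (1 + Polynomial.X) 0 (by simp) (by simp)) _ _ h3
end

section
/- Let p be a prime number with p ≡ 1 (mod 4) (equivalently, p is odd and −1 is a square in ℚ_p). Then for every monic irreducible polynomial π ∈ ℚ_p[t], at least one of the elements t, t+1, t(t+1) is a square in the π-adic completion of the rational function field ℚ_p(t). -/
open IsDedekindDomain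

theorem aux_sqrt {K : Type*} [NormedField K] [IsUltrametricDist K] [CompleteSpace K]
    (h2 : ‖(2:K)‖ = 1) (x : K) (hx : ‖x‖ < 1) : IsSquare (1 + x) := by
  have h20 : (2:K) ≠ 0 := by
    intro h; rw [h] at h2; simp at h2
  let s : Set K := Metric.closedBall 0 ‖x‖
  let f : K → K := fun y => (x - y ^ 2) / 2
  have hs : IsComplete s := (Metric.isClosed_closedBall).isComplete
  have hm : Set.MapsTo f s s := by
    intro y hy
    simp only [s, f, mem_closedBall_zero_iff] at *
    rw [norm_div, h2, div_one, sub_eq_add_neg]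
    refine (IsUltrametricDist.norm_add_le_max _ _).trans (max_le le_rfl ?_)
    rw [norm_neg, norm_pow]
    nlinarith [norm_nonneg y, norm_nonneg x]
  have hc : ContractingWith ‖x‖₊ (hm.restrict f s s) := by
    refine ⟨by exact_mod_cast hx, LipschitzWith.of_dist_le_mul ?_⟩
    rintro ⟨y, hy⟩ ⟨z, hz⟩
    simp only [s, mem_closedBall_zero_iff] at hy hz
    simp only [Subtype.dist_eq, Set.MapsTo.val_restrict_apply, f, dist_eq_norm]
    have : (x - y ^ 2) / 2 - (x - z ^ 2) / 2 = -((y + z) * (y - z)) / 2 := by ring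
    rw [this, norm_div, h2, div_one, norm_neg, norm_mul]
    gcongr
    exact (IsUltrametricDist.norm_add_le_max _ _).trans (max_le hy hz)
  obtain ⟨y, -, hy, -⟩ := hc.exists_fixedPoint' hs hm (x := 0) (by simp [s]) (edist_ne_top _ _)
  have hy' : (x - y ^ 2) / 2 = y := hy
  refine ⟨1 + y, ?_⟩
  field_simp at hy'
  linear_combination hy'

theorem aux_fin {F : Type*} [Field F] [Finite F] (a b : F) : IsSquare a ∨ IsSquare b ∨ IsSquare (a * b) := by
  classical
  have := Fintype.ofFinite F
  by_cases h2 : ringChar F = 2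
  · exact .inl (FiniteField.isSquare_of_char_two h2 a)
  rcases eq_or_ne a 0 with rfl | ha
  · simp
  rcases eq_or_ne b 0 with rfl | hb
  · simp
  by_contra! h
  obtain ⟨h1, h2', h3⟩ := h
  have e1 := (quadraticChar_neg_one_iff_not_isSquare).2 h1
  have e2 := (quadraticChar_neg_one_iff_not_isSquare).2 h2'
  have e3 := (quadraticChar_neg_one_iff_not_isSquare).2 h3
  rw [map_mul, e1, e2] at e3
  norm_num at e3

open scoped NormedField Valued in
theorem aux_res {K : Type*} [NontriviallyNormedField K] [IsUltrametricDist K] [ProperSpace K] :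
   Finite (IsLocalRing.ResidueField (Valued.integer K)) := by
  have : CompactSpace (Valued.integer K) := by
    apply isCompact_iff_compactSpace.mp
    convert isCompact_closedBall (0:K) 1
    ext x
    rw [SetLike.mem_coe, Valued.integer.mem_iff]; simp
  have := Valued.integer.isPrincipalIdealRing_of_compactSpace (K := K)
  infer_instance


open scoped NormedField Valued in
theorem aux_unit {K : Type*} [NontriviallyNormedField K] [IsUltrametricDist K] [CompleteSpace K]
    (h2 : ‖(2:K)‖ = 1) (u : Valued.integer K) (hu : ‖(u:K)‖ = 1)
    (hr : IsSquare (IsLocalRing.residue (Valued.integer K) u)) : IsSquare (u : K) := by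
  obtain ⟨r, hr⟩ := hr
  obtain ⟨b, rfl⟩ := IsLocalRing.residue_surjective r
  rw [← map_mul, ← sub_eq_zero, ← map_sub, IsLocalRing.residue_eq_zero_iff,
    IsLocalRing.mem_maximalIdeal, mem_nonunits_iff, Valued.integer.isUnit_iff_norm_eq_one] at hr
  have hle := Valued.integer.norm_le_one (u - b * b)
  have hlt : ‖(u:K) - b * b‖ < 1 := lt_of_le_of_ne hle hr
  have hb : ‖(b:K) * b‖ = 1 := by
    have h := IsUltrametricDist.norm_add_le_max ((u:K) - b * b) (b * b)
    rw [sub_add_cancel, hu] at h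
    have h3 : ‖(b:K)‖ ≤ 1 := Valued.integer.norm_le_one b
    rw [norm_mul] at *
    rcases le_max_iff.1 h with h | h
    · linarith
    · nlinarith [norm_nonneg (b:K)]
  have hb0 : (b:K) ≠ 0 := by rintro h; rw [h] at hb; simp at hb
  obtain ⟨c, hc⟩ := aux_sqrt h2 (((u:K) - b * b) / (b * b)) (by rw [norm_div, hb, div_one]; exact hlt)
  refine ⟨b * c, ?_⟩
  field_simp at hc
  linear_combination hc

open scoped NormedField Valued in
theorem aux_field {K : Type*} [NontriviallyNormedField K] [IsUltrametricDist K] [ProperSpace K]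
    (h2 : ‖(2:K)‖ = 1) (hneg : IsSquare (-1 : K)) (a : K) :
    (a ≠ 0 ∧ IsSquare a) ∨ (a + 1 ≠ 0 ∧ IsSquare (a + 1)) ∨
      (a * (a + 1) ≠ 0 ∧ IsSquare (a * (a + 1))) := by
  rcases eq_or_ne a 0 with rfl | ha
  · simp
  rcases eq_or_ne (a + 1) 0 with h1 | h1
  · left
    obtain rfl : a = -1 := by linear_combination h1
    simpa using hneg
  suffices h : IsSquare a ∨ IsSquare (a + 1) ∨ IsSquare (a * (a + 1)) by
    simpa [ha, h1] using h
  rcases lt_trichotomy ‖a‖ 1 with h | h | h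
  · right; left
    rw [add_comm]; exact aux_sqrt h2 a h
  · have hle : ‖a + 1‖ ≤ 1 := (IsUltrametricDist.norm_add_le_max _ _).trans (by simp [h])
    rcases hle.lt_or_eq with h' | h'
    · left
      have := hneg.mul (aux_sqrt h2 (-(a + 1)) (by rwa [norm_neg]))
      have e : -1 * (1 + -(a + 1)) = a := by ring
      rwa [e] at this
    · have := aux_res (K := K)
      let A : Valued.integer K := ⟨a, Valued.integer.mem_iff.2 h.le⟩
      let B : Valued.integer K := ⟨a + 1, Valued.integer.mem_iff.2 hle⟩
      rcases aux_fin (IsLocalRing.residue _ A) (IsLocalRing.residue _ B) with hh | hh | hh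
      · exact .inl (aux_unit h2 A h hh)
      · exact .inr (.inl (aux_unit h2 B h' hh))
      · rw [← map_mul] at hh
        exact .inr (.inr (aux_unit h2 (A * B) (by simp [A, B, h, h']) hh))
  · right; right
    obtain ⟨c, hc⟩ := aux_sqrt h2 a⁻¹ (by rw [norm_inv]; exact inv_lt_one_of_one_lt₀ h)
    refine ⟨a * c, ?_⟩
    field_simp at hc
    linear_combination a * hc

theorem aux_neg (p : ℕ) [Fact p.Prime] (hp : p % 4 = 1) : ‖(2:ℚ_[p])‖ = 1 ∧ IsSquare (-1 : ℚ_[p]) := by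
  have h2 : ‖(2:ℚ_[p])‖ = 1 := by
    have : ¬ ((p:ℤ) ∣ 2) := by
      intro h
      have := Int.le_of_dvd (by norm_num) h
      have := (Fact.out : p.Prime).two_le
      omega
    have h := mt (Padic.norm_intCast_lt_one_iff (p := p) (k := 2)).1 this
    have h' := Padic.norm_int_le_one (p := p) 2
    push_cast at h h'
    exact le_antisymm h' (not_lt.1 h)
  refine ⟨h2, ?_⟩
  obtain ⟨y, hy⟩ := (ZMod.exists_sq_eq_neg_one_iff (p := p)).2 (by omega)
  obtain ⟨n, rfl⟩ := ZMod.intCast_surjective y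
  have hn : (p : ℤ) ∣ n * n + 1 := by
    rw [← ZMod.intCast_zmod_eq_zero_iff_dvd]; push_cast; rw [← hy]; ring
  have hlt := (Padic.norm_intCast_lt_one_iff (p := p)).2 hn
  push_cast at hlt
  have hn0 : ‖(n:ℚ_[p])‖ = 1 := by
    have h' := Padic.norm_int_le_one (p := p) n
    refine le_antisymm h' (not_lt.1 fun h => ?_)
    have hd := (Padic.norm_intCast_lt_one_iff (p := p)).1 h
    have : (p:ℤ) ∣ 1 := (Int.dvd_add_right (hd.mul_left n)).1 hn
    have := Int.le_of_dvd (by norm_num) this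
    have := (Fact.out : p.Prime).two_le
    omega
  have hnn : (n:ℚ_[p]) ≠ 0 := by rintro h; rw [h] at hn0; simp at hn0
  obtain ⟨c, hc⟩ := aux_sqrt h2 (-((n:ℚ_[p]) * n + 1)) (by rwa [norm_neg])
  refine ⟨c / n, ?_⟩
  field_simp
  linear_combination hc

theorem aux_ext (p : ℕ) [Fact p.Prime] (hp : p % 4 = 1) (L : Type) [Field L] [Algebra ℚ_[p] L]
    [FiniteDimensional ℚ_[p] L] (a : L) :
    (a ≠ 0 ∧ IsSquare a) ∨ (a + 1 ≠ 0 ∧ IsSquare (a + 1)) ∨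
      (a * (a + 1) ≠ 0 ∧ IsSquare (a * (a + 1))) := by
  obtain ⟨h2, hneg⟩ := aux_neg p hp
  let : NontriviallyNormedField L := spectralNorm.nontriviallyNormedField ℚ_[p] L
  let : NormedSpace ℚ_[p] L := spectralNorm.normedSpace ℚ_[p] L
  have : IsUltrametricDist L :=
    IsUltrametricDist.isUltrametricDist_of_isNonarchimedean_norm isNonarchimedean_spectralNorm
  have : ProperSpace L := FiniteDimensional.proper ℚ_[p] L
  refine aux_field ?_ ?_ a
  · rw [← h2, ← map_ofNat (algebraMap ℚ_[p] L) 2]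
    exact spectralNorm_extends _
  · simpa using hneg.map (algebraMap ℚ_[p] L)

theorem aux_compl {F : Type*} [Field F] [CharZero F] (v : HeightOneSpectrum (Polynomial F))
    (q b : Polynomial F) (hq : q ∉ v.asIdeal) (hb : q - b * b ∈ v.asIdeal) :
    ∃ z : v.adicCompletion (RatFunc F),
      z ^ 2 = algebraMap (RatFunc F) (v.adicCompletion (RatFunc F)) (algebraMap _ _ q) := by
  let := Valuation.IsRankOneDiscrete.rankOne
    (Valued.v : Valuation (v.adicCompletion (RatFunc F)) _) (e := 2) (by norm_num)
  let : NormedField (v.adicCompletion (RatFunc F)) := Valued.toNormedField _ _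
  have key1 : ∀ r : Polynomial F, ‖algebraMap (RatFunc F) (v.adicCompletion (RatFunc F)) (algebraMap _ _ r)‖ < 1 ↔ r ∈ v.asIdeal := by
    intro r
    rw [Valued.toNormedField.norm_lt_one_iff]
    have := v.valuation_lt_one_iff_mem (K := RatFunc F) r
    rw [← this, ← HeightOneSpectrum.valuedAdicCompletion_eq_valuation']
    rfl
  have key2 : ∀ r : Polynomial F, r ∉ v.asIdeal → ‖algebraMap (RatFunc F) (v.adicCompletion (RatFunc F)) (algebraMap _ _ r)‖ = 1 := by
    intro r hr
    refine le_antisymm ?_ (not_lt.1 (mt (key1 r).1 hr))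
    rw [Valued.toNormedField.norm_le_one_iff]
    have := v.valuation_le_one (K := RatFunc F) r
    rw [← HeightOneSpectrum.valuedAdicCompletion_eq_valuation'] at this
    exact this
  have hbm : b * b ∉ v.asIdeal := fun h => hq (by simpa using add_mem hb h)
  have h2 : ‖(2 : v.adicCompletion (RatFunc F))‖ = 1 := by
    have := key2 (Polynomial.C 2) fun h => v.isPrime.ne_top
      (Ideal.eq_top_of_isUnit_mem _ h (Polynomial.isUnit_C.2 (by simp)))
    rw [map_ofNat Polynomial.C 2, map_ofNat _ 2, map_ofNat _ 2] at this
    exact this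
  have hB := key2 _ hbm
  have hQ := (key1 _).2 hb
  simp only [map_sub, map_mul] at hB hQ
  set B := algebraMap (RatFunc F) (v.adicCompletion (RatFunc F)) (algebraMap _ _ b)
  set Q := algebraMap (RatFunc F) (v.adicCompletion (RatFunc F)) (algebraMap _ _ q)
  have hB0 : B ≠ 0 := by rintro h; rw [h] at hB; simp at hB
  obtain ⟨c, hc⟩ := aux_sqrt h2 ((Q - B * B) / (B * B)) (by rw [norm_div, hB, div_one]; exact hQ)
  refine ⟨B * c, ?_⟩
  field_simp at hc
  linear_combination -hc



/-- Let `p ≡ 1 (mod 4)` be a prime.  For every monic irreducible polynomial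
`π ∈ ℚ_p[t]`, at least one of the elements `t`, `t + 1`, `t(t + 1)` is a square in the
`π`-adic completion of the rational function field `ℚ_p(t)` (the completion of `ℚ_p(t)` at
the height-one prime `(π)` of `ℚ_p[t]`). -/
theorem square_in_completion (p : ℕ) [Fact p.Prime] (hp : p % 4 = 1)
    (π : Polynomial ℚ_[p]) (hmonic : π.Monic) (hirr : Irreducible π)
    (v : HeightOneSpectrum (Polynomial ℚ_[p])) (hv : v.asIdeal = Ideal.span {π}) :
    (∃ z : v.adicCompletion (RatFunc ℚ_[p]),
      z ^ 2 = algebraMap (RatFunc ℚ_[p]) (v.adicCompletion (RatFunc ℚ_[p])) RatFunc.X) ∨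
    (∃ z : v.adicCompletion (RatFunc ℚ_[p]),
      z ^ 2 = algebraMap (RatFunc ℚ_[p]) (v.adicCompletion (RatFunc ℚ_[p]))
        (RatFunc.X + 1)) ∨
    (∃ z : v.adicCompletion (RatFunc ℚ_[p]),
      z ^ 2 = algebraMap (RatFunc ℚ_[p]) (v.adicCompletion (RatFunc ℚ_[p]))
        (RatFunc.X * (RatFunc.X + 1))) := by
  have : Fact (Irreducible π) := ⟨hirr⟩
  have : FiniteDimensional ℚ_[p] (AdjoinRoot π) :=
    (AdjoinRoot.powerBasis hirr.ne_zero).finite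
  have hmem : ∀ r, r ∈ v.asIdeal ↔ AdjoinRoot.mk π r = 0 := by
    intro r
    rw [hv, Ideal.mem_span_singleton, AdjoinRoot.mk_eq_zero]
  have key : ∀ q : Polynomial ℚ_[p], AdjoinRoot.mk π q ≠ 0 → IsSquare (AdjoinRoot.mk π q) →
      ∃ z : v.adicCompletion (RatFunc ℚ_[p]), z ^ 2 =
        algebraMap (RatFunc ℚ_[p]) (v.adicCompletion (RatFunc ℚ_[p])) (algebraMap _ _ q) := by
    rintro q h0 ⟨r, hr⟩
    obtain ⟨b, rfl⟩ := AdjoinRoot.mk_surjective r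
    refine aux_compl v q b (by rwa [hmem]) ?_
    rw [hmem, map_sub, map_mul, hr, sub_self]
  rcases aux_ext p hp (AdjoinRoot π) (AdjoinRoot.root π) with ⟨h0, h⟩ | ⟨h0, h⟩ | ⟨h0, h⟩
  · left
    simpa using key Polynomial.X (by simpa using h0) (by simpa using h)
  · right; left
    have := key (Polynomial.X + 1) (by simpa using h0) (by simpa using h)
    rwa [map_add (algebraMap _ (RatFunc ℚ_[p])), RatFunc.algebraMap_X,
      map_one (algebraMap _ (RatFunc ℚ_[p]))] at this
  · right; right
    have := key (Polynomial.X * (Polynomial.X + 1)) (by simpa using h0) (by simpa using h)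
    rwa [map_mul (algebraMap _ (RatFunc ℚ_[p])), map_add (algebraMap _ (RatFunc ℚ_[p])),
      RatFunc.algebraMap_X, map_one (algebraMap _ (RatFunc ℚ_[p]))] at this
end
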